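/- For all integers d₁, d₂, d₃, e₁, e₂, e₃, setting α₁ = d₁H₁+d₂H₂+d₃H₃, α₂ = d₂H₁+d₁H₂+d₃H₃ and β = e₁H₁+e₂H₂+e₃H₃, the coefficient of H₁²H₂²H₃ in [X]·((α₁−β)³ − (α₂−β)³) equals 12(d₁−d₂)(e₁−e₂)((d₁+d₂+d₃)−(e₁+e₂+e₃)). (This is the full simplification of the difference ∫_X c₁(Hom(L₃,L₁))³ − ∫_X c₁(Hom(L₃,L₂))³, where Hom(L₃,Lᵢ) = L₃^∨⊗Lᵢ and L₁ = O(d₁,d₂,d₃)|_X, L₂ = O(d₂,d₁,d₃)|_X, L₃ = O(e₁,e₂,e₃)|_X.) In particular the difference is nonzero for general choices of the six integers. -/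

import Mathlib

open MvPolynomial Finset

noncomputable section

/-- The three hyperplane classes `H₁, H₂, H₃` of `ℙ²×ℙ²×ℙ¹`,
as variables of the polynomial ring `ℤ[H₁,H₂,H₃]`. -/
def H1 : MvPolynomial (Fin 3) ℤ := X 0
def H2 : MvPolynomial (Fin 3) ℤ := X 1
def H3 : MvPolynomial (Fin 3) ℤ := X 2

/-- `∫p` : the coefficient of `H₁²H₂²H₃` in `p`, i.e. the degree map of
`ℙ²×ℙ²×ℙ¹` normalized by `H₁·H₁·H₂·H₂·H₃ = 1`. -/
def intX (p : MvPolynomial (Fin 3) ℤ) : ℤ :=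
  coeff (Finsupp.single 0 2 + Finsupp.single 1 2 + Finsupp.single 2 1) p

/-- `[X] = (2H₁+2H₂)(H₁+H₂+2H₃)`, the class of the complete-intersection
Calabi-Yau 3-fold `X ⊂ ℙ²×ℙ²×ℙ¹` cut out by a section of `O(2,2,0) ⊕ O(1,1,2)`. -/
def Xcls : MvPolynomial (Fin 3) ℤ := (2 * H1 + 2 * H2) * (H1 + H2 + 2 * H3)

/-- The pushforward of `c₁(O(d₁,d₂,d₃)|_X)`, i.e. the linear form `d₁H₁+d₂H₂+d₃H₃`. -/
def L (d₁ d₂ d₃ : ℤ) : MvPolynomial (Fin 3) ℤ := C d₁ * H1 + C d₂ * H2 + C d₃ * H3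

/-- `σ = (1+H₁)³(1+H₂)³(1+H₃)² · (Σ_{k<6} (−(2H₁+2H₂))^k) · (Σ_{k<6} (−(H₁+H₂+2H₃))^k)`,
the truncated total Chern class of `T_X` divided by `[X]` (adjunction formula with
truncated geometric series for the inverses). -/
def sigmaX : MvPolynomial (Fin 3) ℤ :=
  (1 + H1) ^ 3 * (1 + H2) ^ 3 * (1 + H3) ^ 2 *
    (∑ k ∈ Finset.range 6, (-(2 * H1 + 2 * H2)) ^ k) *
    (∑ k ∈ Finset.range 6, (-(H1 + H2 + 2 * H3)) ^ k)

theorem intX_X_pow_mul {i : Fin 3} {n : ℕ}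
    (h : (Finsupp.single 0 2 + Finsupp.single 1 2 + Finsupp.single 2 1 : Fin 3 →₀ ℕ) i < n)
    (p : MvPolynomial (Fin 3) ℤ) : intX (X i ^ n * p) = 0 := by
  rw [intX, X_pow_eq_monomial, coeff_monomial_mul', if_neg]
  rw [Finsupp.single_le_iff]
  exact h.not_ge

theorem intX_C_mul_top (k : ℤ) : intX (C k * (H1 ^ 2 * H2 ^ 2 * H3)) = k := by
  have h : H1 ^ 2 * H2 ^ 2 * H3 =
      monomial (Finsupp.single 0 2 + Finsupp.single 1 2 + Finsupp.single 2 1) 1 := by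
    simp only [H1, H2, H3, X_pow_eq_monomial, monomial_mul, mul_one]
    rw [X, monomial_mul, mul_one]
  rw [intX, coeff_C_mul, h, coeff_monomial, if_pos rfl, mul_one]

theorem intX_add (p q : MvPolynomial (Fin 3) ℤ) : intX (p + q) = intX p + intX q :=
  coeff_add _ _ _

theorem intX_sub (p q : MvPolynomial (Fin 3) ℤ) : intX (p - q) = intX p - intX q :=
  coeff_sub _ _ _ _

theorem L_sub (a b c a' b' c' : ℤ) : L a b c - L a' b' c' = L (a - a') (b - b') (c - c') := by
  simp only [L, map_sub]
  ring

/-- The cubic intersection form of `X`. -/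
theorem intX_Xcls_mul_L_pow_three (a b c : ℤ) :
    intX (Xcls * L a b c ^ 3) =
      6 * (a ^ 2 + b ^ 2) * c + 24 * a * b * c + 12 * a * b * (a + b) := by
  let A : MvPolynomial (Fin 3) ℤ := C a
  let B : MvPolynomial (Fin 3) ℤ := C b
  let D : MvPolynomial (Fin 3) ℤ := C c
  have key : Xcls * L a b c ^ 3 =
      C (6 * (a ^ 2 + b ^ 2) * c + 24 * a * b * c + 12 * a * b * (a + b)) *
        (H1 ^ 2 * H2 ^ 2 * H3) +
      X 0 ^ 3 * (2 * (A ^ 3 * H1 ^ 2 + (3 * A ^ 2 * B + 2 * A ^ 3) * H1 * H2 +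
        (3 * A * B ^ 2 + 6 * A ^ 2 * B + A ^ 3) * H2 ^ 2 +
        H3 * ((3 * D * A ^ 2 + 2 * A ^ 3) * H1 +
          (3 * D * (2 * A * B + 2 * A ^ 2) + 2 * (3 * A ^ 2 * B + A ^ 3)) * H2))) +
      X 1 ^ 3 * (2 * (B ^ 3 * H2 ^ 2 + (3 * A * B ^ 2 + 2 * B ^ 3) * H1 * H2 +
        (3 * A ^ 2 * B + 6 * A * B ^ 2 + B ^ 3) * H1 ^ 2 +
        H3 * ((3 * D * B ^ 2 + 2 * B ^ 3) * H2 +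
          (3 * D * (2 * A * B + 2 * B ^ 2) + 2 * (3 * A * B ^ 2 + B ^ 3)) * H1))) +
      X 2 ^ 2 * (2 * (H1 + H2) * ((H1 + H2 + 2 * H3) *
        (3 * D ^ 2 * (A * H1 + B * H2) + D ^ 3 * H3) + 6 * D * (A * H1 + B * H2) ^ 2)) := by
    simp only [A, B, D, Xcls, L, H1, H2, H3, map_add, map_mul, map_pow, map_ofNat]
    ring
  rw [key, intX_add, intX_add, intX_add, intX_C_mul_top, intX_X_pow_mul, intX_X_pow_mul,
    intX_X_pow_mul]
  · ring
  all_goals simp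

/-- `∫c₁(Hom(L₃,L₁))³ − ∫c₁(Hom(L₃,L₂))³ = 12(d₁−d₂)(e₁−e₂)((d₁+d₂+d₃)−(e₁+e₂+e₃))`
where `Hom(L₃,Lᵢ) = L₃^∨⊗Lᵢ` has first Chern class `αᵢ−β`; in particular the
difference is nonzero for general choices of the six integers. -/
theorem statement12 (d₁ d₂ d₃ e₁ e₂ e₃ : ℤ) :
    intX (Xcls * ((L d₁ d₂ d₃ - L e₁ e₂ e₃) ^ 3 - (L d₂ d₁ d₃ - L e₁ e₂ e₃) ^ 3)) =
      12 * (d₁ - d₂) * (e₁ - e₂) * ((d₁ + d₂ + d₃) - (e₁ + e₂ + e₃)) ∧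
    ((d₁ - d₂) * (e₁ - e₂) * ((d₁ + d₂ + d₃) - (e₁ + e₂ + e₃)) ≠ 0 →
      intX (Xcls * (L d₁ d₂ d₃ - L e₁ e₂ e₃) ^ 3) ≠
      intX (Xcls * (L d₂ d₁ d₃ - L e₁ e₂ e₃) ^ 3)) := by
  have h : intX (Xcls * (L d₁ d₂ d₃ - L e₁ e₂ e₃) ^ 3) -
      intX (Xcls * (L d₂ d₁ d₃ - L e₁ e₂ e₃) ^ 3) =
      12 * (d₁ - d₂) * (e₁ - e₂) * ((d₁ + d₂ + d₃) - (e₁ + e₂ + e₃)) := by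
    rw [L_sub, L_sub, intX_Xcls_mul_L_pow_three, intX_Xcls_mul_L_pow_three]
    ring
  refine ⟨by rw [mul_sub, intX_sub, h], fun hne heq => hne ?_⟩
  rw [heq, sub_self] at h
  linarith

end
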